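/- For every real α ≥ 0, every real ε > 0 and every deterministic delayed-decision algorithm with reservations for online Feedback Vertex Set, there exists an instance (n, G) with μ(G) ≥ 1 whose cost with reservation cost α exceeds (min{1 + 3α, 4} − ε)·μ(G). In other words, no such algorithm achieves a strict competitive ratio better than min{1 + 3α, 4}. -/

import Mathlib

open SimpleGraph

/-- `S` is a feedback vertex set of `G`: removing `S` leaves an acyclic induced subgraph. -/
def IsFVS {n : ℕ} (G : SimpleGraph (Fin n)) (S : Finset (Fin n)) : Prop :=
  (G.induce {v : Fin n | v ∉ S}).IsAcyclic

/-- `fvsNum G` is the minimum size of a feedback vertex set of `G`. -/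
noncomputable def fvsNum {n : ℕ} (G : SimpleGraph (Fin n)) : ℕ :=
  sInf {k : ℕ | ∃ S : Finset (Fin n), IsFVS G S ∧ S.card = k}

/-- A deterministic delayed-decision algorithm for online Feedback Vertex Set.
Vertices of an instance `(n, G)` arrive in the order `0, 1, …, n-1`; after the `i`-th
arrival the algorithm has irrevocably selected the set `S n G i ⊆ {0, …, i-1}`. -/
structure DelayedFVSAlgorithm where
  /-- the set selected after seeing the first `i` vertices -/
  S : ∀ n : ℕ, SimpleGraph (Fin n) → ℕ → Finset (Fin n)
  /-- only already presented vertices may be selected -/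
  mem_lt : ∀ (n : ℕ) (G : SimpleGraph (Fin n)) (i : ℕ) (v : Fin n),
    v ∈ S n G i → (v : ℕ) < i
  /-- determinism/online condition: on instances agreeing on their `i`-th prefix, the
  selected sets agree -/
  online : ∀ (n m : ℕ) (G : SimpleGraph (Fin n)) (G' : SimpleGraph (Fin m)) (i : ℕ)
      (hn : i ≤ n) (hm : i ≤ m),
      (∀ x y : Fin i, G.Adj (Fin.castLE hn x) (Fin.castLE hn y) ↔
        G'.Adj (Fin.castLE hm x) (Fin.castLE hm y)) →
      (S n G i).image Fin.val = (S m G' i).image Fin.val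
  /-- decisions are irrevocable -/
  irrevocable : ∀ (n : ℕ) (G : SimpleGraph (Fin n)) (i : ℕ), i < n →
    S n G i ⊆ S n G (i + 1)
  /-- a valid partial solution is maintained: the subgraph induced on the presented,
  non-selected vertices is acyclic -/
  valid : ∀ (n : ℕ) (G : SimpleGraph (Fin n)) (i : ℕ), i ≤ n →
    (G.induce {v : Fin n | (v : ℕ) < i ∧ v ∉ S n G i}).IsAcyclic

/-- A deterministic delayed-decision algorithm with reservations for online
Feedback Vertex Set: besides the irrevocably selected set `S`, the algorithm may
reserve a set `R` of vertices. -/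
structure DelayedFVSAlgorithmRes where
  /-- the set of irrevocably selected vertices after seeing the first `i` vertices -/
  S : ∀ n : ℕ, SimpleGraph (Fin n) → ℕ → Finset (Fin n)
  /-- the set of reserved vertices after seeing the first `i` vertices -/
  R : ∀ n : ℕ, SimpleGraph (Fin n) → ℕ → Finset (Fin n)
  memS_lt : ∀ (n : ℕ) (G : SimpleGraph (Fin n)) (i : ℕ) (v : Fin n),
    v ∈ S n G i → (v : ℕ) < i
  memR_lt : ∀ (n : ℕ) (G : SimpleGraph (Fin n)) (i : ℕ) (v : Fin n),
    v ∈ R n G i → (v : ℕ) < i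
  /-- determinism/online condition -/
  online : ∀ (n m : ℕ) (G : SimpleGraph (Fin n)) (G' : SimpleGraph (Fin m)) (i : ℕ)
      (hn : i ≤ n) (hm : i ≤ m),
      (∀ x y : Fin i, G.Adj (Fin.castLE hn x) (Fin.castLE hn y) ↔
        G'.Adj (Fin.castLE hm x) (Fin.castLE hm y)) →
      (S n G i).image Fin.val = (S m G' i).image Fin.val ∧
      (R n G i).image Fin.val = (R m G' i).image Fin.val
  irrevocableS : ∀ (n : ℕ) (G : SimpleGraph (Fin n)) (i : ℕ), i < n →
    S n G i ⊆ S n G (i + 1)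
  irrevocableR : ∀ (n : ℕ) (G : SimpleGraph (Fin n)) (i : ℕ), i < n →
    R n G i ⊆ R n G (i + 1)
  /-- the selected vertices together with the reserved ones form a valid partial
  solution: the subgraph induced on the remaining presented vertices is acyclic -/
  valid : ∀ (n : ℕ) (G : SimpleGraph (Fin n)) (i : ℕ), i ≤ n →
    (G.induce {v : Fin n | (v : ℕ) < i ∧ v ∉ S n G i ∪ R n G i}).IsAcyclic

/-- The cost of an algorithm with reservations on the instance `(n, G)` with
reservation cost `α`: the irrevocably selected vertices, plus the minimum number of
further vertices needed to complete them to a feedback vertex set, plus `α` per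
reserved vertex. -/
noncomputable def resCost (A : DelayedFVSAlgorithmRes) (α : ℝ) (n : ℕ)
    (G : SimpleGraph (Fin n)) : ℝ :=
  ((A.S n G n).card : ℝ) +
    ((sInf {k : ℕ | ∃ T : Finset (Fin n), IsFVS G (A.S n G n ∪ T) ∧ T.card = k} : ℕ) : ℝ) +
    α * ((A.R n G n).card : ℝ)

/-! ### Restricting a graph to a vertex set -/

/-- The subgraph of `H` on the same vertex type keeping only the edges inside `W`. -/
def restrictTo {V : Type*} (H : SimpleGraph V) (W : Set V) : SimpleGraph V where
  Adj a b := H.Adj a b ∧ a ∈ W ∧ b ∈ W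
  symm := ⟨fun _ _ h => ⟨h.1.symm, h.2.2, h.2.1⟩⟩
  loopless := ⟨fun _ h => h.1.ne rfl⟩

/-- `S` hits every cycle of `H`. -/
def HitsCycles {V : Type*} (H : SimpleGraph V) (S : Set V) : Prop :=
  (restrictTo H Sᶜ).IsAcyclic

theorem restrictTo_le {V : Type*} (H : SimpleGraph V) (W : Set V) : restrictTo H W ≤ H :=
  fun _ _ h => h.1

theorem restrictTo_mono {V : Type*} {H H' : SimpleGraph V} {W W' : Set V} (hH : H ≤ H')
    (hW : W ⊆ W') : restrictTo H W ≤ restrictTo H' W' :=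
  fun _ _ h => ⟨hH h.1, hW h.2.1, hW h.2.2⟩

theorem HitsCycles.mono {V : Type*} {H : SimpleGraph V} {S S' : Set V} (h : HitsCycles H S)
    (hS : S ⊆ S') : HitsCycles H S' :=
  IsAcyclic.anti (restrictTo_mono le_rfl (Set.compl_subset_compl.2 hS)) h

theorem isAcyclic_restrictTo {V : Type*} {H : SimpleGraph V} {W : Set V}
    (h : (H.induce W).IsAcyclic) : (restrictTo H W).IsAcyclic := by
  rw [isAcyclic_iff_free_cycleGraph] at h ⊢
  intro k hk ⟨f⟩
  have hf : ∀ i, f i ∈ W := by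
    intro i
    obtain ⟨j, hj⟩ : ∃ j, (cycleGraph k).Adj i j := by
      obtain ⟨k, rfl⟩ : ∃ l, k = l + 2 := ⟨k - 2, by omega⟩
      exact ⟨i + 1, by simp [cycleGraph_adj]⟩
    exact (f.toHom.map_adj hj).2.1
  exact h k hk ⟨⟨⟨fun i => ⟨f i, hf i⟩, fun {a b} hab => (f.toHom.map_adj hab).1⟩,
    fun a b hab => f.injective (congrArg Subtype.val hab)⟩⟩

theorem not_reachable_of_closed {V : Type*} {G : SimpleGraph V} {u v : V} (C : Set V)
    (hC : ∀ a ∈ C, ∀ b, G.Adj a b → b ∈ C) (hu : u ∈ C) (hv : v ∉ C) : ¬ G.Reachable u v := by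
  rintro ⟨w⟩
  apply hv
  clear hv
  induction w with
  | nil => exact hu
  | cons h _ ih => exact ih (hC _ hu _ h)

theorem not_reachable_restrictTo {V : Type*} {H : SimpleGraph V} {S : Set V} {u v : V}
    (huv : u ≠ v) (h : u ∈ S ∨ v ∈ S) : ¬ (restrictTo H Sᶜ).Reachable u v := by
  rcases h with h | h
  · exact not_reachable_of_closed {u} (by rintro _ rfl b hb; exact absurd h hb.2.1) rfl huv.symm
  · intro hr
    exact not_reachable_of_closed {v} (by rintro _ rfl b hb; exact absurd h hb.2.1) rfl huv hr.symm

/-- Two edges from `x` to the ends of a connection avoiding `x` form a cycle. -/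
theorem not_isAcyclic_of_reachable {V : Type*} {G K : SimpleGraph V} {x u v : V} (hK : K ≤ G)
    (hx : ∀ a, ¬ K.Adj x a) (hxu : G.Adj x u) (hxv : G.Adj x v) (huv : u ≠ v)
    (hr : K.Reachable u v) : ¬ G.IsAcyclic := by
  intro hG
  have hle : K ⊔ edge x v ⊔ edge x u ≤ G := by
    refine sup_le (sup_le hK ?_) ?_
    · exact (edge_le_iff _).2 (Or.inr hxv)
    · exact (edge_le_iff _).2 (Or.inr hxu)
  have h1 : (K ⊔ edge x v).Reachable x u := by
    have h2 : (K ⊔ edge x v).Adj x v := by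
      rw [sup_adj, edge_adj]
      exact Or.inr ⟨Or.inl ⟨rfl, rfl⟩, hxv.ne⟩
    exact h2.reachable.trans (hr.symm.mono le_sup_left)
  rcases (isAcyclic_sup_fromEdgeSet_iff.1 (hG.anti hle)).2 h1 with h | h
  · exact hxu.ne h
  · rw [sup_adj, edge_adj] at h
    rcases h with h | ⟨⟨-, h⟩ | ⟨h, -⟩, -⟩
    · exact hx _ h
    · exact huv h
    · exact hxv.ne h

/-! ### Presenting a graph on `ℕ` to the algorithm -/

namespace DelayedFVSAlgorithmRes

/-- The vertices selected or reserved on the restriction of `H` to `{0, …, n-1}`. -/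
def removed (B : DelayedFVSAlgorithmRes) (n : ℕ) (H : SimpleGraph ℕ) : Finset ℕ :=
  (B.S n (H.comap Fin.val) n ∪ B.R n (H.comap Fin.val) n).image Fin.val

variable {B : DelayedFVSAlgorithmRes} {n m : ℕ} {H H' : SimpleGraph ℕ}

theorem lt_of_mem_removed {d : ℕ} (h : d ∈ B.removed n H) : d < n := by
  obtain ⟨a, -, rfl⟩ := Finset.mem_image.1 h
  exact a.2

theorem removed_subset (hnm : n ≤ m) (h : ∀ a < n, ∀ b < n, H.Adj a b ↔ H'.Adj a b) :
    B.removed n H ⊆ B.removed m H' := by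
  have honl := B.online n m (H.comap Fin.val) (H'.comap Fin.val) n le_rfl hnm
    (fun x y => h x x.2 y y.2)
  have hmono : ∀ k, n + k ≤ m → B.S m (H'.comap Fin.val) n ⊆ B.S m (H'.comap Fin.val) (n + k) ∧
      B.R m (H'.comap Fin.val) n ⊆ B.R m (H'.comap Fin.val) (n + k) := by
    intro k
    induction k with
    | zero => exact fun _ => ⟨subset_rfl, subset_rfl⟩
    | succ k ih =>
      intro hk
      have := ih (by omega)
      exact ⟨this.1.trans (B.irrevocableS _ _ _ (by omega)),
        this.2.trans (B.irrevocableR _ _ _ (by omega))⟩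
  obtain ⟨hS, hR⟩ := hmono (m - n) (by omega)
  rw [Nat.add_sub_cancel' hnm] at hS hR
  unfold removed
  rw [Finset.image_union, Finset.image_union, honl.1, honl.2]
  exact Finset.union_subset_union (Finset.image_subset_image hS) (Finset.image_subset_image hR)

theorem isAcyclic_restrictTo_removed :
    (restrictTo H {a | a < n ∧ a ∉ B.removed n H}).IsAcyclic := by
  apply isAcyclic_restrictTo
  refine IsAcyclic.comap ⟨fun a => ⟨⟨a.1, a.2.1⟩, a.2.1, fun h =>
    a.2.2 (Finset.mem_image.2 ⟨_, h, rfl⟩)⟩, fun {a b} hab => hab⟩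
    ?_ (B.valid n (H.comap Fin.val) n le_rfl)
  exact fun a b hab => Subtype.ext (congrArg (fun x => x.1.1) hab)

end DelayedFVSAlgorithmRes

/-! ### The adversary's moves -/

/-- Every edge of `H` lies inside `{0, …, n-1}`. -/
def SupportedBelow (H : SimpleGraph ℕ) (n : ℕ) : Prop :=
  ∀ a b, H.Adj a b → a < n

/-- Present the vertex `n` with neighbours `u` and `v`. -/
def addVertex (H : SimpleGraph ℕ) (n u v : ℕ) : SimpleGraph ℕ :=
  H ⊔ edge n u ⊔ edge n v

section addVertex

variable {H : SimpleGraph ℕ} {n u v : ℕ}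

theorem le_addVertex : H ≤ addVertex H n u v :=
  le_sup_left.trans le_sup_left

theorem addVertex_adj (hu : u < n) (hv : v < n) {a b : ℕ} : (addVertex H n u v).Adj a b ↔
    H.Adj a b ∨ (a = n ∧ (b = u ∨ b = v)) ∨ (b = n ∧ (a = u ∨ a = v)) := by
  simp only [addVertex, sup_adj, edge_adj]
  constructor
  · rintro ((h | ⟨⟨rfl, rfl⟩ | ⟨rfl, rfl⟩, -⟩) | ⟨⟨rfl, rfl⟩ | ⟨rfl, rfl⟩, -⟩) <;> simp_all
  · rintro (h | ⟨rfl, rfl | rfl⟩ | ⟨rfl, rfl | rfl⟩)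
    · exact Or.inl (Or.inl h)
    · exact Or.inl (Or.inr ⟨by simp, by omega⟩)
    · exact Or.inr ⟨by simp, by omega⟩
    · exact Or.inl (Or.inr ⟨by simp, by omega⟩)
    · exact Or.inr ⟨by simp, by omega⟩

theorem supportedBelow_addVertex (hs : SupportedBelow H n) (hu : u < n) (hv : v < n) :
    SupportedBelow (addVertex H n u v) (n + 1) := by
  intro a b hab
  rcases (addVertex_adj hu hv).1 hab with h | h | h
  · have := hs _ _ h
    omega
  · omega
  · omega

theorem removed_subset_addVertex (B : DelayedFVSAlgorithmRes) (hu : u < n) (hv : v < n) :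
    B.removed n H ⊆ B.removed (n + 1) (addVertex H n u v) := by
  apply DelayedFVSAlgorithmRes.removed_subset (Nat.le_succ n)
  intro a ha b hb
  rw [addVertex_adj hu hv]
  constructor
  · exact Or.inl
  · rintro (h | h | h)
    · exact h
    · omega
    · omega

theorem hitsCycles_addVertex (hs : SupportedBelow H n) (hu : u < n) (hv : v < n) {S : Set ℕ}
    (hS : HitsCycles H S) (huv : u = v ∨ ¬ (restrictTo H Sᶜ).Reachable u v) :
    HitsCycles (addVertex H n u v) S := by
  have hn : ∀ w, w < n → ¬ (restrictTo H Sᶜ).Reachable n w := fun w hw =>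
    not_reachable_of_closed {n} (by rintro _ rfl b hb; exact absurd (hs _ _ hb.1) (lt_irrefl _))
      rfl (by simp; omega)
  have h1 : (restrictTo H Sᶜ ⊔ edge n u).IsAcyclic := hS.sup_edge_of_not_reachable (hn u hu)
  rcases huv with rfl | huv
  · refine h1.anti fun a b ⟨hab, ha, hb⟩ => ?_
    rw [sup_adj, edge_adj]
    rcases (addVertex_adj hu hu).1 hab with h | h | h
    · exact Or.inl ⟨h, ha, hb⟩
    · exact Or.inr (by omega)
    · exact Or.inr (by omega)
  · have h2 : ¬ (restrictTo H Sᶜ ⊔ edge n u).Reachable n v := by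
      refine not_reachable_of_closed ({n} ∪ {a | (restrictTo H Sᶜ).Reachable u a}) ?_
        (Or.inl rfl) ?_
      · rintro a ha b hab
        rw [sup_adj, edge_adj] at hab
        rcases hab with hab | ⟨⟨rfl, rfl⟩ | ⟨rfl, rfl⟩, -⟩
        · rcases ha with rfl | ha
          · exact absurd (hs _ _ hab.1) (lt_irrefl _)
          · exact Or.inr (Reachable.trans ha hab.reachable)
        · exact Or.inr (Reachable.refl _)
        · exact Or.inl rfl
      · rintro (h | h)
        · exact hv.ne h
        · exact huv h
    refine (h1.sup_edge_of_not_reachable h2).anti fun a b ⟨hab, ha, hb⟩ => ?_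
    rw [sup_adj, sup_adj, edge_adj, edge_adj]
    rcases (addVertex_adj hu hv).1 hab with h | h | h
    · exact Or.inl (Or.inl ⟨h, ha, hb⟩)
    · rcases h with ⟨h, h' | h'⟩
      · exact Or.inl (Or.inr (by omega))
      · exact Or.inr (by omega)
    · rcases h with ⟨h, h' | h'⟩
      · exact Or.inl (Or.inr (by omega))
      · exact Or.inr (by omega)

theorem hitsCycles_addVertex_of_mem (hs : SupportedBelow H n) (hu : u < n) (hv : v < n) {S : Set ℕ}
    (hS : HitsCycles H S) (huv : u ∈ S ∨ v ∈ S) : HitsCycles (addVertex H n u v) S := by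
  refine hitsCycles_addVertex hs hu hv hS ?_
  by_cases h : u = v
  · exact Or.inl h
  · exact Or.inr (not_reachable_restrictTo h huv)

theorem not_isAcyclic_addVertex (hs : SupportedBelow H n) (hu : u < n) (hv : v < n) (huv : u ≠ v)
    (hr : H.Reachable u v) : ¬ (addVertex H n u v).IsAcyclic :=
  not_isAcyclic_of_reachable le_addVertex (fun _ h => absurd (hs _ _ h) (lt_irrefl _))
    ((addVertex_adj hu hv).2 (by simp)) ((addVertex_adj hu hv).2 (by simp)) huv hr

theorem exists_mem_removed_addVertex (B : DelayedFVSAlgorithmRes) {W : Set ℕ}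
    (hu : u ∈ W) (hv : v ∈ W) (hW : ∀ a ∈ W, a < n) (huv : u ≠ v)
    (hr : (restrictTo H W).Reachable u v) :
    ∃ d ∈ B.removed (n + 1) (addVertex H n u v), d ∈ W ∨ d = n := by
  by_contra! hcon
  have hmem : ∀ a ∈ W, a < n + 1 ∧ a ∉ B.removed (n + 1) (addVertex H n u v) := fun a ha =>
    ⟨(hW a ha).trans (Nat.lt_succ_self n), fun h => (hcon a h).1 ha⟩
  have hmem' : n < n + 1 ∧ n ∉ B.removed (n + 1) (addVertex H n u v) :=
    ⟨Nat.lt_succ_self n, fun h => (hcon n h).2 rfl⟩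
  refine not_isAcyclic_of_reachable (x := n) (K := restrictTo H W)
    (restrictTo_mono le_addVertex hmem)
    (fun a h => (hW _ h.2.1).ne rfl) ⟨?_, hmem', hmem u hu⟩ ⟨?_, hmem', hmem v hv⟩ huv hr
    (DelayedFVSAlgorithmRes.isAcyclic_restrictTo_removed (B := B) (n := n + 1)
      (H := addVertex H n u v))
  · exact (addVertex_adj (hW u hu) (hW v hv)).2 (by simp)
  · exact (addVertex_adj (hW u hu) (hW v hv)).2 (by simp)

end addVertex

/-! ### Fresh paths -/

/-- Present the path `n, n+1, …, n+k`, disjoint from everything presented before. -/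
def addPath (H : SimpleGraph ℕ) (n : ℕ) : ℕ → SimpleGraph ℕ
  | 0 => H
  | k + 1 => addVertex (addPath H n k) (n + k + 1) (n + k) (n + k)

section addPath

variable {H : SimpleGraph ℕ} {n : ℕ}

theorem addPath_adj (k : ℕ) {a b : ℕ} : (addPath H n k).Adj a b ↔
    H.Adj a b ∨ (n ≤ a ∧ n ≤ b ∧ a ≤ n + k ∧ b ≤ n + k ∧ (a + 1 = b ∨ b + 1 = a)) := by
  induction k with
  | zero =>
    refine ⟨Or.inl, fun h => h.elim id fun h => ?_⟩
    omega
  | succ k ih =>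
    rw [addPath, addVertex_adj (Nat.lt_succ_self _) (Nat.lt_succ_self _), ih]
    by_cases h : H.Adj a b
    · simp [h]
    · simp only [h, false_or]
      omega

theorem le_addPath (k : ℕ) : H ≤ addPath H n k :=
  fun _ _ h => (addPath_adj k).2 (Or.inl h)

theorem supportedBelow_addPath (hs : SupportedBelow H n) (k : ℕ) :
    SupportedBelow (addPath H n k) (n + k + 1) := by
  intro a b hab
  rcases (addPath_adj k).1 hab with h | h
  · have := hs _ _ h
    omega
  · omega

theorem removed_subset_addPath (B : DelayedFVSAlgorithmRes) (k : ℕ) :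
    B.removed n H ⊆ B.removed (n + k + 1) (addPath H n k) := by
  apply DelayedFVSAlgorithmRes.removed_subset (by omega)
  intro a ha b hb
  rw [addPath_adj k]
  refine ⟨Or.inl, fun h => h.elim id fun h => ?_⟩
  omega

theorem hitsCycles_addPath (hs : SupportedBelow H n) {S : Set ℕ} (hS : HitsCycles H S) (k : ℕ) :
    HitsCycles (addPath H n k) S := by
  induction k with
  | zero => exact hS
  | succ k ih =>
    exact hitsCycles_addVertex (supportedBelow_addPath hs k) (Nat.lt_succ_self _)
      (Nat.lt_succ_self _) ih (Or.inl rfl)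

end addPath

/-! ### The adversary's invariant -/

/-- A path `p 0, …, p (L-1)` of `H` avoiding a set `E` of removed vertices. -/
structure LivePath (B : DelayedFVSAlgorithmRes) (n : ℕ) (H : SimpleGraph ℕ) (E : Finset ℕ)
    (L : ℕ) (p : ℕ → ℕ) : Prop where
  supp : SupportedBelow H n
  subset_removed : E ⊆ B.removed n H
  lt : ∀ i < L, p i < n
  inj : ∀ i < L, ∀ j < L, p i = p j → i = j
  adj : ∀ i, i + 1 < L → H.Adj (p i) (p (i + 1))
  notMem : ∀ i < L, p i ∉ E

section LivePath

variable {B : DelayedFVSAlgorithmRes} {n m L : ℕ} {H : SimpleGraph ℕ} {E X : Finset ℕ}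
  {p q : ℕ → ℕ}

theorem LivePath.addVertex (hp : LivePath B n H E L p) {u v : ℕ} (hu : u < n) (hv : v < n) :
    LivePath B (n + 1) (addVertex H n u v) E L p where
  supp := supportedBelow_addVertex hp.supp hu hv
  subset_removed := hp.subset_removed.trans (removed_subset_addVertex B hu hv)
  lt i hi := (hp.lt i hi).trans (Nat.lt_succ_self n)
  inj := hp.inj
  adj i hi := le_addVertex (hp.adj i hi)
  notMem := hp.notMem

theorem LivePath.insert (hp : LivePath B n H E L p) {d : ℕ} (hd : d ∈ B.removed n H)
    (hpd : ∀ i < L, p i ≠ d) : LivePath B n H (insert d E) L p where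
  supp := hp.supp
  subset_removed := Finset.insert_subset hd hp.subset_removed
  lt := hp.lt
  inj := hp.inj
  adj := hp.adj
  notMem i hi h := (Finset.mem_insert.1 h).elim (hpd i hi) (hp.notMem i hi)

theorem LivePath.shift (hp : LivePath B n H E m p) (t : ℕ) (ht : t + L ≤ m) :
    LivePath B n H E L (fun i => p (t + i)) where
  supp := hp.supp
  subset_removed := hp.subset_removed
  lt i hi := hp.lt _ (by omega)
  inj i hi j hj h := by
    have := hp.inj _ (by omega) _ (by omega) h
    omega
  adj i hi := hp.adj (t + i) (by omega)
  notMem i hi := hp.notMem _ (by omega)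

theorem LivePath.exists_shift_avoiding (hp : LivePath B n H E (2 * L) p) {d : ℕ}
    (hd : d ∈ B.removed n H) :
    ∃ t, t + L ≤ 2 * L ∧ LivePath B n H (Insert.insert d E) L (fun i => p (t + i)) := by
  by_cases h : ∀ i < L, p (0 + i) ≠ d
  · exact ⟨0, by omega, (hp.shift 0 (by omega)).insert hd h⟩
  · push Not at h
    obtain ⟨i, hi, hid⟩ := h
    refine ⟨L, by omega, (hp.shift L (by omega)).insert hd fun j hj hjd => ?_⟩
    have := hp.inj _ (by omega) _ (by omega) (hid.trans hjd.symm)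
    omega

/-- The adversary has forced `4 * m` removals, while all cycles are hit by the `m` vertices
of `X` together with an arbitrary vertex of a live path. -/
structure Forced (B : DelayedFVSAlgorithmRes) (m n : ℕ) (H : SimpleGraph ℕ) (E X : Finset ℕ)
    (L : ℕ) (p : ℕ → ℕ) : Prop where
  path : LivePath B n H E L p
  cyclic : m = 0 ∨ ¬ H.IsAcyclic
  card_removed : E.card = 4 * m
  card_le : X.card ≤ m
  hits : ∀ i < L, HitsCycles H (insert (p i) (X : Set ℕ))

/-- The last forced removal of a round: a triangle through `h` and `z` while only `h` is put
into the feedback vertex set. -/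
theorem exists_forced_of_edge (hp : LivePath B n H E L p) {h z : ℕ} (hcyc : ¬ H.IsAcyclic)
    (hhz : H.Adj h z) (hE : h ∉ E) (hzE : z ∉ E) (hcard : E.card = 4 * m + 3) (hX : X.card ≤ m)
    (hph : ∀ i < L, p i ≠ h) (hpz : ∀ i < L, p i ≠ z)
    (hits : ∀ i < L, HitsCycles H (insert (p i) (insert h (X : Set ℕ)))) :
    ∃ n' H' E' X', Forced B (m + 1) n' H' E' X' L p := by
  have hn : h < n := hp.supp _ _ hhz
  have hzn : z < n := hp.supp _ _ hhz.symm
  have hr : (restrictTo H {h, z}).Reachable h z :=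
    Adj.reachable ⟨hhz, by simp, by simp⟩
  obtain ⟨d, hd, hd'⟩ := exists_mem_removed_addVertex B (W := {h, z}) (by simp) (by simp)
    (by rintro a (rfl | rfl) <;> assumption) hhz.ne hr
  have hdE : d ∉ E := by
    rcases hd' with (rfl | rfl) | rfl
    · exact hE
    · exact hzE
    · exact fun hd => lt_irrefl _ (DelayedFVSAlgorithmRes.lt_of_mem_removed (hp.subset_removed hd))
  refine ⟨n + 1, addVertex H n h z, insert d E, insert h X, (hp.addVertex hn hzn).insert hd ?_,
    Or.inr fun hac => hcyc (hac.anti le_addVertex), ?_, ?_, ?_⟩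
  · intro i hi
    rcases hd' with (rfl | rfl) | rfl
    · exact hph i hi
    · exact hpz i hi
    · exact (hp.lt i hi).ne
  · rw [Finset.card_insert_of_notMem hdE, hcard]
    ring
  · exact (Finset.card_insert_le _ _).trans (by omega)
  · intro i hi
    rw [Finset.coe_insert]
    exact hitsCycles_addVertex_of_mem hp.supp hn hzn (hits i hi) (Or.inl (by simp))

/-- The last two forced removals of a round, on the child path `q`. -/
theorem exists_forced_of_child (hp : LivePath B n H E L p) (hq : LivePath B n H E 4 q)
    (hcyc : ¬ H.IsAcyclic) (hcard : E.card = 4 * m + 2) (hX : X.card ≤ m)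
    (hpq : ∀ i < L, ∀ j < 4, p i ≠ q j)
    (hits : ∀ i < L, ∀ j, j = 1 ∨ j = 2 →
      HitsCycles H (insert (p i) (insert (q j) (X : Set ℕ)))) :
    ∃ n' H' E' X', Forced B (m + 1) n' H' E' X' L p := by
  have h1 := hq.lt 1 (by omega)
  have h2 := hq.lt 2 (by omega)
  have h12 : H.Adj (q 1) (q 2) := hq.adj 1 (by omega)
  obtain ⟨d, hd, hd'⟩ := exists_mem_removed_addVertex B (W := {q 1, q 2}) (by simp)
    (by simp) (by rintro a (rfl | rfl) <;> assumption) h12.ne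
    (Adj.reachable ⟨h12, by simp, by simp⟩)
  have hdE : d ∉ E := by
    rcases hd' with (rfl | rfl) | rfl
    · exact hq.notMem 1 (by omega)
    · exact hq.notMem 2 (by omega)
    · exact fun hd => lt_irrefl _ (DelayedFVSAlgorithmRes.lt_of_mem_removed (hp.subset_removed hd))
  have hp' : LivePath B (n + 1) (addVertex H n (q 1) (q 2)) (insert d E) L p := by
    refine (hp.addVertex h1 h2).insert hd fun i hi => ?_
    rcases hd' with (rfl | rfl) | rfl
    · exact hpq i hi 1 (by omega)
    · exact hpq i hi 2 (by omega)
    · exact (hp.lt i hi).ne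
  have hcyc' : ¬ (addVertex H n (q 1) (q 2)).IsAcyclic := fun hac => hcyc (hac.anti le_addVertex)
  have hcard' : (insert d E).card = 4 * m + 3 := by
    rw [Finset.card_insert_of_notMem hdE, hcard]
  have hits' : ∀ i < L, ∀ j, j = 1 ∨ j = 2 →
      HitsCycles (addVertex H n (q 1) (q 2)) (insert (p i) (insert (q j) (X : Set ℕ))) := by
    intro i hi j hj
    refine hitsCycles_addVertex_of_mem hp.supp h1 h2 (hits i hi j hj) ?_
    rcases hj with rfl | rfl <;> simp
  have hlive : ∀ j < 4, q j ≠ d → q j ∉ insert d E := fun j hj hjd h =>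
    (Finset.mem_insert.1 h).elim hjd (hq.notMem j hj)
  have hinj : ∀ i < 4, ∀ j < 4, i ≠ j → q i ≠ q j := fun i hi j hj hij h =>
    hij (hq.inj i hi j hj h)
  have hqn : ∀ j < 4, q j ≠ n := fun j hj => (hq.lt j hj).ne
  by_cases hd2 : d = q 2
  · refine exists_forced_of_edge hp' (h := q 1) (z := q 0) hcyc'
      (le_addVertex (hq.adj 0 (by omega)).symm) (hlive 1 (by omega) ?_) (hlive 0 (by omega) ?_)
      hcard' hX (fun i hi => hpq i hi 1 (by omega)) (fun i hi => hpq i hi 0 (by omega))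
      (fun i hi => hits' i hi 1 (Or.inl rfl))
    · rw [hd2]
      exact hinj 1 (by omega) 2 (by omega) (by omega)
    · rw [hd2]
      exact hinj 0 (by omega) 2 (by omega) (by omega)
  · refine exists_forced_of_edge hp' (h := q 2) (z := q 3) hcyc'
      (le_addVertex (hq.adj 2 (by omega))) (hlive 2 (by omega) (Ne.symm hd2))
      (hlive 3 (by omega) ?_) hcard' hX (fun i hi => hpq i hi 2 (by omega))
      (fun i hi => hpq i hi 3 (by omega)) (fun i hi => hits' i hi 2 (Or.inr rfl))
    rcases hd' with (rfl | rfl) | rfl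
    · exact hinj 3 (by omega) 1 (by omega) (by omega)
    · exact absurd rfl hd2
    · exact hqn 3 (by omega)

/-- Linking two paths lying in different components by two connections forces a removal, and
one of the two paths keeps both ends of its connections. -/
theorem exists_forced_of_link (hp : LivePath B n H E (L + 4) p) (hq : LivePath B n H E (L + 4) q)
    (hcyc : ¬ H.IsAcyclic) (hcard : E.card = 4 * m + 1) (hX : X.card ≤ m)
    {C : Set ℕ} (hC : ∀ a b, H.Adj a b → (a ∈ C ↔ b ∈ C)) (hCn : ∀ a ∈ C, a < n)
    (hpC : ∀ i < L + 4, p i ∈ C) (hqC : ∀ i < L + 4, q i ∉ C)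
    (hits : ∀ i < L + 4, ∀ j < L + 4, HitsCycles H (insert (p i) (insert (q j) (X : Set ℕ)))) :
    ∃ n' H' E' X' p', Forced B (m + 1) n' H' E' X' L p' := by
  have hp1 := hp.lt 1 (by omega)
  have hp2 := hp.lt 2 (by omega)
  have hq1 := hq.lt 1 (by omega)
  have hq2 := hq.lt 2 (by omega)
  have hpq : ∀ i < L + 4, ∀ j < L + 4, p i ≠ q j := fun i hi j hj h =>
    hqC j hj (h ▸ hpC i hi)
  set H₁ := addVertex H n (p 1) (q 1) with hH₁
  set H₂ := addVertex H₁ (n + 1) (p 2) (q 2) with hH₂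
  have hp' : LivePath B (n + 1) H₁ E (L + 4) p := hp.addVertex hp1 hq1
  have hp'' : LivePath B (n + 1 + 1) H₂ E (L + 4) p := hp'.addVertex (by omega) (by omega)
  have hq'' : LivePath B (n + 1 + 1) H₂ E (L + 4) q :=
    (hq.addVertex hp1 hq1).addVertex (by omega) (by omega)
  have hcyc' : ¬ H₂.IsAcyclic := fun hac =>
    hcyc (hac.anti (le_addVertex.trans le_addVertex))
  have hadj : ∀ {a b}, H₁.Adj a b ↔ H.Adj a b ∨ (a = n ∧ (b = p 1 ∨ b = q 1)) ∨
      (b = n ∧ (a = p 1 ∨ a = q 1)) := addVertex_adj hp1 hq1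
  have hits₁ : ∀ S : Set ℕ, HitsCycles H S → HitsCycles H₁ S := by
    intro S hS
    refine hitsCycles_addVertex hp.supp hp1 hq1 hS (Or.inr ?_)
    exact not_reachable_of_closed C (fun a ha b hab => (hC _ _ hab.1).1 ha) (hpC 1 (by omega))
      (hqC 1 (by omega))
  have hits₂ : ∀ S : Set ℕ, (p 1 ∈ S ∨ p 2 ∈ S ∨ q 1 ∈ S ∨ q 2 ∈ S) → HitsCycles H S →
      HitsCycles H₂ S := by
    intro S hmem hS
    have hS₁ := hits₁ S hS
    rcases hmem with h | h | h | h
    · refine hitsCycles_addVertex hp'.supp (by omega) (by omega) hS₁ (Or.inr ?_)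
      refine not_reachable_of_closed C ?_ (hpC 2 (by omega)) (hqC 2 (by omega))
      rintro a ha b ⟨hab, haS, hbS⟩
      rcases hadj.1 hab with hab | ⟨rfl, -⟩ | ⟨rfl, rfl | rfl⟩
      · exact (hC _ _ hab).1 ha
      · exact absurd (hCn _ ha) (lt_irrefl _)
      · exact absurd h haS
      · exact absurd ha (hqC 1 (by omega))
    · exact hitsCycles_addVertex_of_mem hp'.supp (by omega) (by omega) hS₁ (Or.inl h)
    · refine hitsCycles_addVertex hp'.supp (by omega) (by omega) hS₁ (Or.inr ?_)
      refine not_reachable_of_closed (C ∪ {n}) ?_ (Or.inl (hpC 2 (by omega))) ?_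
      · rintro a ha b ⟨hab, haS, hbS⟩
        rcases hadj.1 hab with hab' | ⟨rfl, rfl | rfl⟩ | ⟨rfl, -⟩
        · rcases ha with ha | rfl
          · exact Or.inl ((hC _ _ hab').1 ha)
          · exact absurd (hp.supp _ _ hab') (lt_irrefl _)
        · exact Or.inl (hpC 1 (by omega))
        · exact absurd h hbS
        · exact Or.inr rfl
      · rintro (h' | h')
        · exact hqC 2 (by omega) h'
        · exact hq2.ne h'
    · exact hitsCycles_addVertex_of_mem hp'.supp (by omega) (by omega) hS₁ (Or.inr h)
  have hr : (restrictTo H₁ {p 1, p 2, q 1, q 2, n}).Reachable (p 2) (q 2) := by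
    have e1 : (restrictTo H₁ {p 1, p 2, q 1, q 2, n}).Adj (p 1) (p 2) :=
      ⟨le_addVertex (hp.adj 1 (by omega)), by simp, by simp⟩
    have e2 : (restrictTo H₁ {p 1, p 2, q 1, q 2, n}).Adj (p 1) n :=
      ⟨hadj.2 (by simp), by simp, by simp⟩
    have e3 : (restrictTo H₁ {p 1, p 2, q 1, q 2, n}).Adj n (q 1) :=
      ⟨hadj.2 (by simp), by simp, by simp⟩
    have e4 : (restrictTo H₁ {p 1, p 2, q 1, q 2, n}).Adj (q 1) (q 2) :=
      ⟨le_addVertex (hq.adj 1 (by omega)), by simp, by simp⟩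
    exact e1.symm.reachable.trans (e2.reachable.trans (e3.reachable.trans e4.reachable))
  obtain ⟨d, hd, hd'⟩ := exists_mem_removed_addVertex B (n := n + 1)
    (W := {p 1, p 2, q 1, q 2, n}) (by simp) (by simp)
    (by rintro a (rfl | rfl | rfl | rfl | rfl) <;> omega) (hpq 2 (by omega) 2 (by omega)) hr
  have hEn : ∀ a ∈ E, a < n := fun a ha =>
    DelayedFVSAlgorithmRes.lt_of_mem_removed (hp.subset_removed ha)
  have hdE : d ∉ E := by
    rcases hd' with (rfl | rfl | rfl | rfl | rfl) | rfl
    · exact hp.notMem 1 (by omega)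
    · exact hp.notMem 2 (by omega)
    · exact hq.notMem 1 (by omega)
    · exact hq.notMem 2 (by omega)
    · exact fun h => lt_irrefl _ (hEn _ h)
    · exact fun h => absurd (hEn _ h) (by omega)
  have hcard' : (insert d E).card = 4 * m + 2 := by
    rw [Finset.card_insert_of_notMem hdE, hcard]
  have main : ∀ r c : ℕ → ℕ, LivePath B (n + 1 + 1) H₂ E (L + 4) r →
      LivePath B (n + 1 + 1) H₂ E (L + 4) c → (∀ i < L + 4, ∀ j < L + 4, r i ≠ c j) →
      (∀ i < L + 4, c i ≠ d) → (∀ i < L, r (4 + i) ≠ d) →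
      (∀ i < L + 4, ∀ j, j = 1 ∨ j = 2 →
        HitsCycles H₂ (insert (r i) (insert (c j) (X : Set ℕ)))) →
      ∃ n' H' E' X' p', Forced B (m + 1) n' H' E' X' L p' := by
    intro r c hr hc hrc hcd hrd hits
    obtain ⟨n', H', E', X', hF⟩ := exists_forced_of_child (L := L) (p := fun i => r (4 + i))
      ((hr.shift 4 (by omega)).insert hd hrd)
      (((hc.shift 0 (L := 4) (by omega)).insert hd fun i hi => hcd (0 + i) (by omega)))
      hcyc' hcard' hX (fun i hi j hj => hrc _ (by omega) _ (by omega))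
      (fun i hi j hj => hits _ (by omega) _ (by omega))
    exact ⟨n', H', E', X', _, hF⟩
  by_cases hdq : d = q 1 ∨ d = q 2
  · refine main q p hq'' hp'' (fun i hi j hj h => hpq j hj i hi h.symm) ?_ ?_ ?_
    · intro i hi h
      rcases hdq with hdq | hdq
      · exact hpq i hi 1 (by omega) (h.trans hdq)
      · exact hpq i hi 2 (by omega) (h.trans hdq)
    · intro i hi h
      rcases hdq with hdq | hdq
      · have := hq.inj _ (by omega) _ (by omega) (h.trans hdq)
        omega
      · have := hq.inj _ (by omega) _ (by omega) (h.trans hdq)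
        omega
    · intro i hi j hj
      rw [Set.insert_comm]
      refine hits₂ _ ?_ (hits j (by omega) i hi)
      rcases hj with rfl | rfl <;> simp
  · refine main p q hp'' hq'' hpq ?_ ?_ ?_
    · rintro i hi rfl
      rcases hd' with (h | h | h | h | h) | h
      · exact hpq _ (by omega) _ hi h.symm
      · exact hpq _ (by omega) _ hi h.symm
      · exact hdq (Or.inl h)
      · exact hdq (Or.inr h)
      · exact (hq.lt i hi).ne h
      · exact absurd (hq.lt i hi) (by omega)
    · rintro i hi rfl
      have hlt := hp.lt (4 + i) (by omega)
      rcases hd' with (h | h | h | h | h) | h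
      · have := hp.inj _ (by omega) _ (by omega) h
        omega
      · have := hp.inj _ (by omega) _ (by omega) h
        omega
      · exact hdq (Or.inl h)
      · exact hdq (Or.inr h)
      · exact hlt.ne h
      · omega
    · intro i hi j hj
      refine hits₂ _ ?_ (hits i hi j (by omega))
      rcases hj with rfl | rfl <;> simp

theorem Forced.exists_succ (hF : Forced B m n H E X (L + 4) p) :
    ∃ n' H' E' X' p', Forced B (m + 1) n' H' E' X' L p' := by
  have hs := hF.path.supp
  have hEn : ∀ a ∈ E, a < n := fun a ha =>
    DelayedFVSAlgorithmRes.lt_of_mem_removed (hF.path.subset_removed ha)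
  set k := 2 * (L + 4) - 1 with hk
  set H₁ := addPath H n k with hH₁
  set N := n + k + 1 with hN
  have hs₁ : SupportedBelow H₁ N := supportedBelow_addPath hs k
  have hsub : E ⊆ B.removed N H₁ := hF.path.subset_removed.trans (removed_subset_addPath B k)
  have hp₁ : LivePath B N H₁ E (L + 4) p :=
    { supp := hs₁
      subset_removed := hsub
      lt := fun i hi => (hF.path.lt i hi).trans (by omega)
      inj := hF.path.inj
      adj := fun i hi => le_addPath k (hF.path.adj i hi)
      notMem := hF.path.notMem }
  have hq₁ : LivePath B N H₁ E (2 * (L + 4)) (fun i => n + i) :=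
    { supp := hs₁
      subset_removed := hsub
      lt := fun i hi => by omega
      inj := fun i _ j _ h => by omega
      adj := fun i hi => (addPath_adj k).2 (Or.inr (by omega))
      notMem := fun i hi h => absurd (hEn _ h) (by omega) }
  have hadj₁ : ∀ {a b}, H₁.Adj a b → (a < n ∧ b < n) ∨
      (n ≤ a ∧ n ≤ b ∧ (a + 1 = b ∨ b + 1 = a)) := by
    intro a b hab
    rcases (addPath_adj k).1 hab with h | h
    · exact Or.inl ⟨hs _ _ h, hs _ _ h.symm⟩
    · exact Or.inr ⟨h.1, h.2.1, h.2.2.2.2⟩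
  have hreach : ∀ j ≤ k, (restrictTo H₁ {a | n ≤ a ∧ a < N}).Reachable n (n + j) := by
    intro j
    induction j with
    | zero => exact fun _ => Reachable.refl _
    | succ j ih =>
      intro hj
      refine (ih (by omega)).trans (Adj.reachable ⟨(addPath_adj k).2 (Or.inr (by omega)), ?_, ?_⟩)
      · exact ⟨by omega, by omega⟩
      · exact ⟨by omega, by omega⟩
  have hu : n < N := by omega
  have hv : n + k < N := by omega
  have huv : n ≠ n + k := by omega
  set H₂ := addVertex H₁ N n (n + k) with hH₂
  obtain ⟨d, hd, hd'⟩ := exists_mem_removed_addVertex B (W := {a | n ≤ a ∧ a < N})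
    ⟨le_rfl, hu⟩ ⟨by omega, hv⟩ (fun a ha => ha.2) huv (hreach k le_rfl)
  have hnd : n ≤ d := by
    rcases hd' with h | h
    · exact h.1
    · omega
  obtain ⟨t, ht, hq₂⟩ := (hq₁.addVertex hu hv).exists_shift_avoiding hd
  have hp₂ := (hp₁.addVertex hu hv).insert hd fun i hi h => absurd (hF.path.lt i hi) (by omega)
  refine exists_forced_of_link (C := {a | a < n}) (X := X) hp₂ hq₂ ?_ ?_ hF.card_le ?_ ?_
    hF.path.lt ?_ ?_
  · exact not_isAcyclic_addVertex hs₁ hu hv huv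
      ((hreach k le_rfl).mono (restrictTo_le _ _))
  · rw [Finset.card_insert_of_notMem fun h => absurd (hEn _ h) (by omega), hF.card_removed]
  · intro a b hab
    simp only [Set.mem_ofPred_eq]
    rcases (addVertex_adj hu hv).1 hab with h | h | h
    · have := hadj₁ h
      omega
    · omega
    · omega
  · intro a ha
    exact (show a < n from ha).trans (by omega)
  · intro i hi h
    have : n + (t + i) < n := h
    omega
  · intro i hi j hj
    refine hitsCycles_addVertex hs₁ hu hv (hitsCycles_addPath hs
      ((hF.hits i hi).mono ?_) k) (Or.inr ?_)
    · exact Set.insert_subset_insert (Set.subset_insert _ _)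
    · refine not_reachable_of_closed {a | n ≤ a ∧ (a < n + (t + j) ∨ a = n)} ?_
        ⟨le_rfl, Or.inr rfl⟩ ?_
      · rintro a ⟨ha, ha'⟩ b ⟨hab, haS, hbS⟩
        have ha2 : a ≠ n + (t + j) := fun h => haS (by simp [h])
        have hb2 : b ≠ n + (t + j) := fun h => hbS (by simp [h])
        have := hadj₁ hab
        refine ⟨by omega, by omega⟩
      · rintro ⟨-, h⟩
        omega

theorem exists_forced (B : DelayedFVSAlgorithmRes) (m : ℕ) :
    ∀ L, ∃ n H E X p, Forced B m n H E X L p := by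
  induction m with
  | zero =>
    intro L
    have hs : SupportedBelow (⊥ : SimpleGraph ℕ) 0 := fun a b h => h.elim
    refine ⟨0 + L + 1, addPath ⊥ 0 L, ∅, ∅, id, ⟨supportedBelow_addPath hs L, by simp, ?_, ?_, ?_,
      by simp⟩, Or.inl rfl, by simp, by simp, fun i _ => ?_⟩
    · exact fun i hi => by simp only [id]; omega
    · exact fun i _ j _ h => h
    · exact fun i hi => (addPath_adj L).2 (Or.inr
        ⟨Nat.zero_le _, Nat.zero_le _, by simp only [id]; omega, by simp only [id]; omega, Or.inl rfl⟩)
    · refine hitsCycles_addPath hs ?_ L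
      exact isAcyclic_bot.anti (restrictTo_le _ _)
  | succ m ih =>
    intro L
    obtain ⟨n, H, E, X, p, hF⟩ := ih (L + 4)
    exact hF.exists_succ

end LivePath

/-! ### The cost of the algorithm on a forced instance -/

theorem isFVS_comap_of_hitsCycles {n : ℕ} {H : SimpleGraph ℕ} {F : Finset ℕ}
    (h : HitsCycles H (F : Set ℕ)) :
    IsFVS (H.comap Fin.val) (Finset.univ.filter fun v : Fin n => v.val ∈ F) := by
  have hF : ∀ a : {v : Fin n | v ∉ Finset.univ.filter fun v : Fin n => v.val ∈ F},
      a.1.val ∈ (F : Set ℕ)ᶜ := fun a => by simpa using a.2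
  refine IsAcyclic.comap (G' := restrictTo H (F : Set ℕ)ᶜ)
    ⟨fun a => a.1.val, fun {a b} hab => ⟨hab, hF a, hF b⟩⟩ ?_ h
  exact fun a b hab => Subtype.ext (Fin.ext hab)

theorem fvsNum_le_card {n : ℕ} {G : SimpleGraph (Fin n)} {S : Finset (Fin n)} (h : IsFVS G S) :
    fvsNum G ≤ S.card :=
  Nat.sInf_le ⟨S, h, rfl⟩

theorem isFVS_univ {n : ℕ} (G : SimpleGraph (Fin n)) : IsFVS G Finset.univ :=
  fun v => absurd (Finset.mem_univ v.1) v.2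

theorem fvsNum_comap_le {n : ℕ} {H : SimpleGraph ℕ} {F : Finset ℕ}
    (h : HitsCycles H (F : Set ℕ)) : fvsNum (H.comap (Fin.val (n := n))) ≤ F.card := by
  refine (fvsNum_le_card (isFVS_comap_of_hitsCycles h)).trans ?_
  refine Finset.card_le_card_of_injOn Fin.val (fun v hv => ?_) Fin.val_injective.injOn
  simpa using hv

theorem one_le_fvsNum_comap {n : ℕ} {H : SimpleGraph ℕ} (hs : SupportedBelow H n)
    (hH : ¬ H.IsAcyclic) : 1 ≤ fvsNum (H.comap (Fin.val (n := n))) := by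
  by_contra hlt
  obtain ⟨S, hS, hcard⟩ := Nat.sInf_mem (s := {k : ℕ | ∃ S : Finset (Fin n),
    IsFVS (H.comap Fin.val) S ∧ S.card = k}) ⟨_, _, isFVS_univ _, rfl⟩
  have h0 : S.card = 0 := hcard.trans (by unfold fvsNum at hlt; omega)
  obtain rfl := Finset.card_eq_zero.1 h0
  apply hH
  have hr : (restrictTo H {a | a < n}).IsAcyclic := by
    apply isAcyclic_restrictTo
    refine IsAcyclic.comap ⟨fun a => ⟨⟨a.1, a.2⟩, Finset.notMem_empty _⟩, fun {a b} hab => hab⟩ ?_ hS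
    exact fun a b hab => Subtype.ext (congrArg (fun x => x.1.1) hab)
  have hle : H ≤ restrictTo H {a | a < n} := fun a b hab => ⟨hab, hs _ _ hab, hs _ _ hab.symm⟩
  exact hr.anti hle

theorem fvsNum_le_resCost {B : DelayedFVSAlgorithmRes} {n : ℕ} (G : SimpleGraph (Fin n)) :
    ∃ t : ℕ, fvsNum G ≤ (B.S n G n).card + t ∧
      ∀ α : ℝ, resCost B α n G = (B.S n G n).card + t + α * (B.R n G n).card := by
  refine ⟨_, ?_, fun α => rfl⟩
  obtain ⟨T, hT, hcard⟩ := Nat.sInf_mem (s := {k : ℕ | ∃ T : Finset (Fin n),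
    IsFVS G (B.S n G n ∪ T) ∧ T.card = k})
    ⟨_, Finset.univ, by rw [Finset.union_eq_right.2 (Finset.subset_univ _)]; exact isFVS_univ G, rfl⟩
  rw [← hcard]
  exact (fvsNum_le_card hT).trans (Finset.card_union_le _ _)

/-- No deterministic delayed-decision algorithm with reservations for online Feedback
Vertex Set achieves a strict competitive ratio better than `min {1 + 3α, 4}`. -/
theorem fvs_reservation_lower_bound (α ε : ℝ) (hα : 0 ≤ α) (hε : 0 < ε)
    (B : DelayedFVSAlgorithmRes) :
    ∃ (n : ℕ) (G : SimpleGraph (Fin n)),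
      1 ≤ fvsNum G ∧
        resCost B α n G > (min (1 + 3 * α) 4 - ε) * (fvsNum G : ℝ) := by
  obtain ⟨m, hm⟩ := exists_nat_gt (4 / ε)
  obtain ⟨n, H, E, X, p, hF⟩ := exists_forced B (m + 1) 1
  have hlow : 1 ≤ fvsNum (H.comap (Fin.val (n := n))) :=
    one_le_fvsNum_comap hF.path.supp (hF.cyclic.resolve_left (Nat.succ_ne_zero m))
  refine ⟨n, H.comap Fin.val, hlow, ?_⟩
  have hup : fvsNum (H.comap (Fin.val (n := n))) ≤ m + 2 := by
    refine (fvsNum_comap_le (F := insert (p 0) X) ?_).trans ?_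
    · rw [Finset.coe_insert]
      exact hF.hits 0 one_pos
    · exact (Finset.card_insert_le _ _).trans (Nat.succ_le_succ hF.card_le)
  have hremoved : 4 * (m + 1) ≤ (B.S n (H.comap Fin.val) n).card +
      (B.R n (H.comap Fin.val) n).card := by
    rw [← hF.card_removed]
    exact (Finset.card_le_card hF.path.subset_removed).trans
      (Finset.card_image_le.trans (Finset.card_union_le _ _))
  obtain ⟨t, ht, hcost⟩ := fvsNum_le_resCost (B := B) (H.comap (Fin.val (n := n)))
  rw [hcost, gt_iff_lt]
  generalize fvsNum (H.comap (Fin.val (n := n))) = μ at *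
  generalize (B.S n (H.comap Fin.val) n).card = s at *
  generalize (B.R n (H.comap Fin.val) n).card = r at *
  have hmin : min (1 + 3 * α) 4 = 1 + 3 * min α 1 := by
    rcases le_total α 1 with h | h
    · rw [min_eq_left h, min_eq_left (by linarith)]
    · rw [min_eq_right h, min_eq_right (by linarith)]
      norm_num
  rw [hmin]
  have hβα : min α 1 ≤ α := min_le_left _ _
  have hβ1 : min α 1 ≤ 1 := min_le_right _ _
  have hβ0 : 0 ≤ min α 1 := le_min hα zero_le_one
  generalize min α 1 = β at *
  rw [div_lt_iff₀ hε] at hm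
  have hμ : (μ : ℝ) ≤ s + t := by exact_mod_cast ht
  have hsr : 4 * ((m : ℝ) + 1) ≤ s + r := by exact_mod_cast hremoved
  have hμ1 : (1 : ℝ) ≤ μ := by exact_mod_cast hlow
  have ht0 : (0 : ℝ) ≤ t := Nat.cast_nonneg t
  have hcost_ge : (1 - β) * μ + β * (4 * (m + 1)) ≤ s + t + α * r := by
    have h1 := mul_le_mul_of_nonneg_left hμ (sub_nonneg.2 hβ1)
    have h2 := mul_le_mul_of_nonneg_left hsr hβ0
    have h3 := mul_le_mul_of_nonneg_right hβα (Nat.cast_nonneg (α := ℝ) r)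
    have h4 := mul_nonneg hβ0 ht0
    linarith
  refine lt_of_lt_of_le ?_ hcost_ge
  rcases Nat.lt_or_ge μ (m + 2) with h | h
  · have hμm : (μ : ℝ) ≤ m + 1 := by exact_mod_cast Nat.lt_succ_iff.1 h
    have h1 := mul_le_mul_of_nonneg_left hμm hβ0
    have h2 := mul_pos hε (zero_lt_one.trans_le hμ1)
    linarith
  · have hμm : (μ : ℝ) = m + 2 := by exact_mod_cast le_antisymm hup h
    rw [hμm]
    nlinarith
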